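/- Let R > 0, q > 0, and λ ≥ π²/R² (the first Dirichlet eigenvalue of −Δ on B_R). Then problem (P) has no classical solution (u, φ) with u > 0 in B_R. -/

import Mathlib

open Metric Real Set

noncomputable section

/-- Euclidean 3-space. -/
abbrev E3 := EuclideanSpace ℝ (Fin 3)

/-- The Laplace operator on functions `ℝ³ → ℝ`. -/
def lap (f : E3 → ℝ) (x : E3) : ℝ :=
  ∑ i : Fin 3, fderiv ℝ (fun y => fderiv ℝ f y (EuclideanSpace.single i 1)) x
    (EuclideanSpace.single i 1)

/-- `(u, φ)` is a classical solution of problem (P) on the ball `B_R`. -/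
def IsSolP (R q lam : ℝ) (u φ : E3 → ℝ) : Prop :=
  ContDiffOn ℝ 2 u (ball 0 R) ∧ ContDiffOn ℝ 2 φ (ball 0 R) ∧
  ContinuousOn u (closedBall 0 R) ∧ ContinuousOn φ (closedBall 0 R) ∧
  (∀ x ∈ ball (0:E3) R, -lap u x = lam * u x + q * |u x| ^ 3 * u x * φ x) ∧
  (∀ x ∈ ball (0:E3) R, -lap φ x = q * |u x| ^ 5) ∧
  (∀ x ∈ sphere (0:E3) R, u x = 0) ∧ (∀ x ∈ sphere (0:E3) R, φ x = 0)

open Filter Topology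

theorem nonneg_of_hasDerivAt_of_isLocalMin {g g' : ℝ → ℝ} {a x : ℝ}
    (hg : ∀ᶠ s in 𝓝 x, HasDerivAt g (g' s) s) (hg' : HasDerivAt g' a x)
    (hmin : IsLocalMin g x) : 0 ≤ a := by
  by_contra! ha
  have hderiv : deriv g =ᶠ[𝓝 x] g' := hg.mono fun s hs => hs.deriv
  have hmax : IsLocalMax g x :=
    isLocalMax_of_deriv_deriv_neg (by rw [hderiv.deriv_eq, hg'.deriv]; exact ha)
      hmin.deriv_eq_zero hg.self_of_nhds.continuousAt
  have hconst : g =ᶠ[𝓝 x] fun _ => g x := by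
    filter_upwards [hmin, hmax] with s h₁ h₂ using le_antisymm h₂ h₁
  have hzero : deriv (deriv g) x = 0 := by
    rw [hconst.deriv.deriv_eq]; simp
  rw [hderiv.deriv_eq, hg'.deriv] at hzero
  exact ha.ne hzero

/-- If the line restriction of a `C²` function is touched from below by `p`, then its second
directional derivative is at least that of `p`. -/
theorem le_fderiv_fderiv_of_touch {f : E3 → ℝ} {R : ℝ} (hf : ContDiffOn ℝ 2 f (ball 0 R))
    {x : E3} (hx : x ∈ ball (0 : E3) R) (v : E3) {p p' : ℝ → ℝ} {a : ℝ}
    (hp : ∀ᶠ s in 𝓝 (0 : ℝ), HasDerivAt p (p' s) s) (hp' : HasDerivAt p' a 0)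
    (h0 : p 0 = f x) (hle : ∀ᶠ s in 𝓝 (0 : ℝ), p s ≤ f (x + s • v)) :
    a ≤ fderiv ℝ (fun y => fderiv ℝ f y v) x v := by
  have hline (s : ℝ) : HasDerivAt (fun s : ℝ => x + s • v) v s := by
    simpa using ((hasDerivAt_id s).smul_const v).const_add x
  have hmem : ∀ᶠ s in 𝓝 (0 : ℝ), x + s • v ∈ ball (0 : E3) R :=
    (hline 0).continuousAt.eventually_mem (isOpen_ball.mem_nhds (by simpa using hx))
  have hd : ∀ y ∈ ball (0 : E3) R, DifferentiableAt ℝ f y := fun y hy =>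
    (hf.contDiffAt (isOpen_ball.mem_nhds hy)).differentiableAt (by norm_num)
  have hd2 : DifferentiableAt ℝ (fun y => fderiv ℝ f y v) (x + (0 : ℝ) • v) := by
    rw [zero_smul, add_zero]
    exact (((hf.contDiffAt (isOpen_ball.mem_nhds hx)).fderiv_right
      (m := 1) (by norm_num)).differentiableAt (by norm_num)).clm_apply
      (differentiableAt_const v)
  have hg : ∀ᶠ s in 𝓝 (0 : ℝ), HasDerivAt (fun s => f (x + s • v) - p s)
      (fderiv ℝ f (x + s • v) v - p' s) s := by
    filter_upwards [hmem, hp] with s hs hps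
    exact ((hd _ hs).hasFDerivAt.comp_hasDerivAt s (hline s)).sub hps
  have hg' : HasDerivAt (fun s => fderiv ℝ f (x + s • v) v - p' s)
      (fderiv ℝ (fun y => fderiv ℝ f y v) x v - a) 0 := by
    have := hd2.hasFDerivAt.comp_hasDerivAt (0 : ℝ) (hline 0)
    rw [zero_smul, add_zero] at this
    exact this.sub hp'
  have hmin : IsLocalMin (fun s => f (x + s • v) - p s) 0 := by
    filter_upwards [hle] with s hs
    simpa [h0] using hs
  linarith [nonneg_of_hasDerivAt_of_isLocalMin hg hg' hmin]

theorem lap_nonneg_of_isLocalMin {f : E3 → ℝ} {R : ℝ} (hf : ContDiffOn ℝ 2 f (ball 0 R))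
    {x : E3} (hx : x ∈ ball (0 : E3) R) (hmin : IsLocalMin f x) : 0 ≤ lap f x := by
  refine Finset.sum_nonneg fun i _ => ?_
  refine le_fderiv_fderiv_of_touch hf hx _ (p := fun _ => f x) (p' := fun _ => 0)
    (Eventually.of_forall fun s => hasDerivAt_const s _) (hasDerivAt_const _ _) rfl ?_
  have hc : Tendsto (fun s : ℝ => x + s • (EuclideanSpace.single i 1 : E3)) (𝓝 0) (𝓝 x) :=
    Continuous.tendsto' (by fun_prop) _ _ (by simp)
  exact hc.eventually hmin

theorem hasDerivAt_norm_line (x : E3) (i : Fin 3) (s : ℝ)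
    (hs : x + s • (EuclideanSpace.single i 1 : E3) ≠ 0) :
    HasDerivAt (fun s : ℝ => ‖x + s • (EuclideanSpace.single i 1 : E3)‖)
      ((x i + s) / ‖x + s • (EuclideanSpace.single i 1 : E3)‖) s := by
  have hline : HasDerivAt (fun s : ℝ => x + s • (EuclideanSpace.single i 1 : E3))
      (EuclideanSpace.single i 1) s := by
    simpa using ((hasDerivAt_id s).smul_const (EuclideanSpace.single i 1 : E3)).const_add x
  have h := hline.norm_sq.sqrt (by simpa using hs)
  simp only [Real.sqrt_sq (norm_nonneg _)] at h
  convert h using 1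
  rw [mul_div_mul_left _ _ two_ne_zero]
  simp [EuclideanSpace.inner_single_right]

/-- Comparison of the Laplacian of `f` with that of a radial function touching `f` from below
away from the origin. -/
theorem radial_le_lap_of_touch {f : E3 → ℝ} {R : ℝ} (hf : ContDiffOn ℝ 2 f (ball 0 R))
    {x : E3} (hx : x ∈ ball (0 : E3) R) (hx0 : x ≠ 0) {P P' : ℝ → ℝ} {a : ℝ}
    (hP : ∀ r, 0 < r → HasDerivAt P (P' r) r) (hP' : HasDerivAt P' a ‖x‖)
    (h0 : P ‖x‖ = f x) (hle : ∀ᶠ y in 𝓝 x, P ‖y‖ ≤ f y) :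
    a + 2 * P' ‖x‖ / ‖x‖ ≤ lap f x := by
  have hr : 0 < ‖x‖ := norm_pos_iff.mpr hx0
  have hi (i : Fin 3) : a * (x i / ‖x‖) ^ 2 + P' ‖x‖ * (1 / ‖x‖ - x i ^ 2 / ‖x‖ ^ 3) ≤
      fderiv ℝ (fun y => fderiv ℝ f y (EuclideanSpace.single i 1)) x
        (EuclideanSpace.single i 1) := by
    have hc : Tendsto (fun s : ℝ => x + s • (EuclideanSpace.single i 1 : E3)) (𝓝 0) (𝓝 x) :=
      Continuous.tendsto' (by fun_prop) _ _ (by simp)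
    have hne : ∀ᶠ s : ℝ in 𝓝 0, x + s • (EuclideanSpace.single i 1 : E3) ≠ 0 :=
      hc.eventually_ne hx0
    have hN := hasDerivAt_norm_line x i 0 (by simpa using hx0)
    refine le_fderiv_fderiv_of_touch hf hx _
      (p := fun s => P ‖x + s • (EuclideanSpace.single i 1 : E3)‖)
      (p' := fun s => P' ‖x + s • (EuclideanSpace.single i 1 : E3)‖ *
        ((x i + s) / ‖x + s • (EuclideanSpace.single i 1 : E3)‖)) ?_ ?_ (by simpa using h0)
      (hc.eventually hle)
    · filter_upwards [hne] with s hs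
      exact (hP _ (norm_pos_iff.mpr hs)).comp s (hasDerivAt_norm_line x i s hs)
    · have h₁ : HasDerivAt (fun s : ℝ => P' ‖x + s • (EuclideanSpace.single i 1 : E3)‖)
          (a * (x i / ‖x‖)) 0 := by
        have hP'' : HasDerivAt P' a ‖x + (0 : ℝ) • (EuclideanSpace.single i 1 : E3)‖ := by
          simpa using hP'
        simpa [Function.comp_def] using hP''.comp (0 : ℝ) hN
      have h₂ := h₁.mul (((hasDerivAt_id (0 : ℝ)).const_add (x i)).div hN (by simpa using hx0))
      refine h₂.congr_deriv ?_
      simp only [Pi.div_apply, id, zero_smul, add_zero]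
      field_simp
  have hsum := Finset.sum_le_sum fun i (_ : i ∈ Finset.univ) => hi i
  refine le_trans (le_of_eq ?_) hsum
  have hsq : ‖x‖ ^ 2 = x 0 ^ 2 + x 1 ^ 2 + x 2 ^ 2 := by
    simp [EuclideanSpace.norm_sq_eq, Fin.sum_univ_three]
  have h2 : x 2 ^ 2 = ‖x‖ ^ 2 - x 0 ^ 2 - x 1 ^ 2 := by linarith
  simp only [Fin.sum_univ_three, div_pow, h2]
  field_simp
  ring

/-- The radial solutions of `-Δ w = k² w` away from the origin are `(A sin kr + B cos kr) / r`. -/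
theorem helmholtz_le_lap_of_touch {f : E3 → ℝ} {R : ℝ} (hf : ContDiffOn ℝ 2 f (ball 0 R))
    {x : E3} (hx : x ∈ ball (0 : E3) R) (hx0 : x ≠ 0) {A B k : ℝ}
    (h0 : (A * sin (k * ‖x‖) + B * cos (k * ‖x‖)) / ‖x‖ = f x)
    (hle : ∀ᶠ y in 𝓝 x, (A * sin (k * ‖y‖) + B * cos (k * ‖y‖)) / ‖y‖ ≤ f y) :
    -(k ^ 2 * f x) ≤ lap f x := by
  have hr : ‖x‖ ≠ 0 := norm_ne_zero_iff.mpr hx0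
  have hs (r : ℝ) : HasDerivAt (fun r => sin (k * r)) (cos (k * r) * k) r := by
    simpa using ((hasDerivAt_id r).const_mul k).sin
  have hc (r : ℝ) : HasDerivAt (fun r => cos (k * r)) (-sin (k * r) * k) r := by
    simpa using ((hasDerivAt_id r).const_mul k).cos
  have hP (r : ℝ) (h : 0 < r) :=
    (((hs r).const_mul A).add ((hc r).const_mul B)).div (hasDerivAt_id r) h.ne'
  have hP' := (((((hc ‖x‖).mul_const k).const_mul A).add
    (((hs ‖x‖).neg.mul_const k).const_mul B)).mul (hasDerivAt_id ‖x‖)).sub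
    ((((hs ‖x‖).const_mul A).add ((hc ‖x‖).const_mul B)).mul_const 1) |>.div
    ((hasDerivAt_id ‖x‖).pow 2) (pow_ne_zero 2 hr)
  have h := radial_le_lap_of_touch hf hx hx0 hP hP' h0 hle
  refine le_trans (le_of_eq ?_) h
  rw [← h0]
  simp
  field_simp
  ring

theorem helmholtz_le_lap_of_touch_zero {f : E3 → ℝ} {R : ℝ}
    (hf : ContDiffOn ℝ 2 f (ball 0 R)) (hR : 0 < R) {k t : ℝ} (hk : 0 ≤ k) (ht : 0 ≤ t)
    (h0 : t = f 0) (hle : ∀ᶠ y in 𝓝 (0 : E3), t * sinc (k * ‖y‖) ≤ f y) :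
    -(k ^ 2 * f 0) ≤ lap f 0 := by
  have hi (i : Fin 3) : -(t * k ^ 2 / 3) ≤
      fderiv ℝ (fun y => fderiv ℝ f y (EuclideanSpace.single i 1)) 0
        (EuclideanSpace.single i 1) := by
    refine le_fderiv_fderiv_of_touch hf (mem_ball_self hR) _
      (p := fun s => t * (1 - (k * s) ^ 2 / 6)) (p' := fun s => -(t * k ^ 2 / 3) * s)
      (Eventually.of_forall fun s => ?_) ?_ (by simpa using h0) ?_
    · refine (((((hasDerivAt_id s).const_mul k).pow 2).div_const 6).const_sub 1).const_mul t
        |>.congr_deriv ?_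
      simp
      ring
    · simpa using (hasDerivAt_id (0 : ℝ)).const_mul (-(t * k ^ 2 / 3))
    · have hc : Tendsto (fun s : ℝ => 0 + s • (EuclideanSpace.single i 1 : E3)) (𝓝 0) (𝓝 0) :=
        Continuous.tendsto' (by fun_prop) _ _ (by simp)
      filter_upwards [hc.eventually hle] with s hs
      refine le_trans (mul_le_mul_of_nonneg_left ?_ ht) hs
      have hn : ‖0 + s • (EuclideanSpace.single i 1 : E3)‖ = |s| := by simp [norm_smul]
      rw [hn]
      have hz : 0 ≤ k * |s| := by positivity
      have hsq : (k * s) ^ 2 = (k * |s|) ^ 2 := by rw [mul_pow, mul_pow, sq_abs]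
      rw [hsq]
      generalize k * |s| = z at hz
      rcases hz.eq_or_lt with rfl | hz
      · simp
      · rw [sinc_of_ne_zero hz.ne', le_div_iff₀ hz]
        linarith [sin_gt_sub_cube hz]
  have hsum := Finset.sum_le_sum fun i (_ : i ∈ Finset.univ) => hi i
  refine le_trans (le_of_eq ?_) hsum
  simp [← h0]
  ring

/-- A superharmonic function vanishing on the boundary is positive inside. -/
theorem pos_of_lap_neg {f : E3 → ℝ} {R : ℝ} (hR : 0 < R) (hf : ContDiffOn ℝ 2 f (ball 0 R))
    (hfc : ContinuousOn f (closedBall 0 R)) (hlap : ∀ x ∈ ball (0 : E3) R, lap f x < 0)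
    (hb : ∀ x ∈ sphere (0 : E3) R, f x = 0) : ∀ x ∈ ball (0 : E3) R, 0 < f x := by
  obtain ⟨m, hm, hmin⟩ := (isCompact_closedBall (0 : E3) R).exists_isMinOn
    ⟨0, mem_closedBall_self hR.le⟩ hfc
  have hnot : ∀ x ∈ ball (0 : E3) R, ¬ IsMinOn f (closedBall 0 R) x := fun x hx h =>
    (hlap x hx).not_ge <| lap_nonneg_of_isLocalMin hf hx <|
      h.isLocalMin (mem_of_superset (isOpen_ball.mem_nhds hx) ball_subset_closedBall)
  have hms : m ∈ sphere (0 : E3) R := by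
    by_contra h
    exact hnot m (by rw [← closedBall_sdiff_sphere]; exact ⟨hm, h⟩) hmin
  intro x hx
  by_contra! hle
  refine hnot x hx fun y hy => ?_
  have := hmin hy
  simp only [mem_ofPred_eq, hb m hms] at this ⊢
  linarith

/-- A positive `u` with zero boundary values cannot satisfy `-Δu > (π/R)² u` on the ball. -/
theorem not_strict_supersolution {R : ℝ} (hR : 0 < R) {u : E3 → ℝ}
    (hu : ContDiffOn ℝ 2 u (ball 0 R)) (huc : ContinuousOn u (closedBall 0 R))
    (hb : ∀ x ∈ sphere (0 : E3) R, u x = 0) (hpos : ∀ x ∈ ball (0 : E3) R, 0 < u x) :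
    ¬ ∀ x ∈ ball (0 : E3) R, lap u x < -((π / R) ^ 2 * u x) := by
  intro hlap
  set k := π / R with hk
  have hk0 : 0 < k := by positivity
  have hkR : k * R = π := by rw [hk]; field_simp
  set K := closedBall (0 : E3) (3 * R / 4) with hK
  have hKsub : K ⊆ ball (0 : E3) R := closedBall_subset_ball (by linarith)
  have hsinc : ∀ y ∈ ball (0 : E3) R, 0 < sinc (k * ‖y‖) := by
    intro y hy
    rcases eq_or_ne y 0 with rfl | hy0
    · simp
    have hz : 0 < k * ‖y‖ := mul_pos hk0 (norm_pos_iff.mpr hy0)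
    rw [sinc_of_ne_zero hz.ne']
    refine div_pos (sin_pos_of_pos_of_lt_pi hz ?_) hz
    rw [← hkR]
    exact mul_lt_mul_of_pos_left (by simpa using hy) hk0
  have hsc : Continuous fun y : E3 => sinc (k * ‖y‖) := by fun_prop
  obtain ⟨x₀, hx₀, hmin₀⟩ := (isCompact_closedBall (0 : E3) (3 * R / 4)).exists_isMinOn
    ⟨0, mem_closedBall_self (by positivity)⟩
    ((huc.mono (hKsub.trans ball_subset_closedBall)).div hsc.continuousOn
      fun y hy => (hsinc y (hKsub hy)).ne')
  set t := u x₀ / sinc (k * ‖x₀‖) with ht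
  have hx₀b := hKsub hx₀
  have ht0 : 0 < t := div_pos (hpos _ hx₀b) (hsinc _ hx₀b)
  have hinner : ∀ y ∈ K, t * sinc (k * ‖y‖) ≤ u y := fun y hy =>
    (le_div_iff₀ (hsinc y (hKsub hy))).mp (hmin₀ hy)
  have hsin (y : E3) (hy : y ≠ 0) : sinc (k * ‖y‖) = sin (k * ‖y‖) / (k * ‖y‖) :=
    sinc_of_ne_zero (mul_pos hk0 (norm_pos_iff.mpr hy)).ne'
  have houter : ∀ y ∈ ball (0 : E3) R, 3 * R / 4 ≤ ‖y‖ → t * sinc (k * ‖y‖) ≤ u y := by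
    set S := closedBall (0 : E3) R \ ball 0 (3 * R / 4) with hS
    have hScomp : IsCompact S := (isCompact_closedBall 0 R).diff isOpen_ball
    have hmemS (y : E3) : y ∈ S ↔ ‖y‖ ≤ R ∧ 3 * R / 4 ≤ ‖y‖ := by simp [hS]
    have hcos : ∀ y ∈ S, cos (k * ‖y‖) < 0 := by
      intro y hy
      rw [hmemS] at hy
      have h₁ : k * ‖y‖ ≤ k * R := mul_le_mul_of_nonneg_left hy.1 hk0.le
      have h₂ : k * (3 * R / 4) ≤ k * ‖y‖ := mul_le_mul_of_nonneg_left hy.2 hk0.le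
      apply cos_neg_of_pi_div_two_lt_of_lt <;> linarith [pi_pos]
    have hS0 : ∀ y ∈ S, 0 < ‖y‖ := fun y hy => by linarith [((hmemS y).mp hy).2]
    intro z hz hzr
    have hzS : z ∈ S := (hmemS z).mpr ⟨(mem_ball_zero_iff.mp hz).le, hzr⟩
    obtain ⟨x₁, hx₁, hmin₁⟩ := hScomp.exists_isMinOn ⟨z, hzS⟩
      (f := fun y => (u y - t * sinc (k * ‖y‖)) / (-cos (k * ‖y‖) / ‖y‖))
      (((huc.mono sdiff_subset).sub (by fun_prop)).div
        (ContinuousOn.div (by fun_prop) (by fun_prop) fun y hy => (hS0 y hy).ne')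
        fun y hy => (div_pos (neg_pos.mpr (hcos y hy)) (hS0 y hy)).ne')
    set m := (u x₁ - t * sinc (k * ‖x₁‖)) / (-cos (k * ‖x₁‖) / ‖x₁‖) with hm
    have hh (y : E3) (hy : y ∈ S) : 0 < -cos (k * ‖y‖) / ‖y‖ :=
      div_pos (neg_pos.mpr (hcos y hy)) (hS0 y hy)
    have hmle (y : E3) (hy : y ∈ S) : m * (-cos (k * ‖y‖) / ‖y‖) ≤ u y - t * sinc (k * ‖y‖) :=
      (le_div_iff₀ (hh y hy)).mp (hmin₁ hy)
    have hmeq : m * (-cos (k * ‖x₁‖) / ‖x₁‖) = u x₁ - t * sinc (k * ‖x₁‖) :=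
      div_mul_cancel₀ _ (hh x₁ hx₁).ne'
    by_contra! hlt
    have hm0 : m < 0 := by
      by_contra! hm0
      linarith [hmle z hzS, mul_nonneg hm0 (hh z hzS).le]
    have hneg : u x₁ - t * sinc (k * ‖x₁‖) < 0 := by
      rw [← hmeq]; exact mul_neg_of_neg_of_pos hm0 (hh x₁ hx₁)
    obtain ⟨hx₁R, hx₁r⟩ := (hmemS x₁).mp hx₁
    have hlt₁ : ‖x₁‖ < R := by
      refine lt_of_le_of_ne hx₁R fun h => ?_
      have hux := hb x₁ (by simpa using h)
      rw [hux, hsin x₁ (norm_pos_iff.mp (hS0 x₁ hx₁)), h, hkR] at hneg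
      simp at hneg
    have hlt₂ : 3 * R / 4 < ‖x₁‖ := by
      refine lt_of_le_of_ne hx₁r fun h => ?_
      linarith [hinner x₁ (by simp [hK, ← h])]
    have hx₁b : x₁ ∈ ball (0 : E3) R := by simpa using hlt₁
    have hx₁0 : x₁ ≠ 0 := norm_pos_iff.mp (hS0 x₁ hx₁)
    have hform (y : E3) (hy : y ≠ 0) :
        (t / k * sin (k * ‖y‖) + -m * cos (k * ‖y‖)) / ‖y‖ =
          t * sinc (k * ‖y‖) + m * (-cos (k * ‖y‖) / ‖y‖) := by
      have := norm_ne_zero_iff.mpr hy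
      rw [hsin y hy]
      field_simp
    have hle : ∀ᶠ y in 𝓝 x₁,
        (t / k * sin (k * ‖y‖) + -m * cos (k * ‖y‖)) / ‖y‖ ≤ u y := by
      have e₁ : ∀ᶠ y : E3 in 𝓝 x₁, ‖y‖ < R :=
        continuous_norm.continuousAt.eventually_lt continuousAt_const hlt₁
      have e₂ : ∀ᶠ y : E3 in 𝓝 x₁, 3 * R / 4 < ‖y‖ :=
        continuousAt_const.eventually_lt continuous_norm.continuousAt hlt₂
      filter_upwards [e₁, e₂] with y h₁ h₂
      have hyS := (hmemS y).mpr ⟨h₁.le, h₂.le⟩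
      rw [hform y (norm_pos_iff.mp (hS0 y hyS))]
      linarith [hmle y hyS]
    have := helmholtz_le_lap_of_touch hu hx₁b hx₁0
      (by rw [hform x₁ hx₁0, hmeq]; ring) hle
    linarith [hlap x₁ hx₁b]
  have hall : ∀ᶠ y in 𝓝 x₀, t * sinc (k * ‖y‖) ≤ u y := by
    filter_upwards [isOpen_ball.mem_nhds hx₀b] with y hy
    rcases le_total ‖y‖ (3 * R / 4) with h | h
    · exact hinner y (by simpa [hK] using h)
    · exact houter y hy h
  have hteq : t * sinc (k * ‖x₀‖) = u x₀ := div_mul_cancel₀ _ (hsinc _ hx₀b).ne'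
  have hlap₀ := hlap x₀ hx₀b
  rcases eq_or_ne x₀ 0 with h0 | h0
  · rw [h0] at hall hlap₀ hteq
    have := helmholtz_le_lap_of_touch_zero hu hR hk0.le ht0.le (by simpa using hteq) hall
    linarith
  · have hform (y : E3) (hy : y ≠ 0) :
        (t / k * sin (k * ‖y‖) + 0 * cos (k * ‖y‖)) / ‖y‖ = t * sinc (k * ‖y‖) := by
      have := norm_ne_zero_iff.mpr hy
      rw [hsin y hy]
      field_simp
      ring
    have := helmholtz_le_lap_of_touch hu hx₀b h0 (by rw [hform x₀ h0, hteq]) (by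
      filter_upwards [hall, eventually_ne_nhds h0] with y hy hy0
      rwa [hform y hy0])
    linarith

/-- If `λ ≥ π²/R²` (the first Dirichlet eigenvalue of `-Δ` on `B_R`), problem (P) has no
classical solution with `u > 0` in `B_R`. -/
theorem nonexistence_large_lambda (R q lam : ℝ) (hR : 0 < R) (hq : 0 < q)
    (hlam : π ^ 2 / R ^ 2 ≤ lam) :
    ¬ ∃ u φ : E3 → ℝ, IsSolP R q lam u φ ∧ ∀ x ∈ ball (0:E3) R, 0 < u x := by
  rintro ⟨u, φ, ⟨hu, hφ, huc, hφc, hequ, heqφ, hub, hφb⟩, hpos⟩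
  have hφpos : ∀ x ∈ ball (0 : E3) R, 0 < φ x := by
    refine pos_of_lap_neg hR hφ hφc (fun x hx => ?_) hφb
    have : 0 < q * |u x| ^ 5 := mul_pos hq (pow_pos (abs_pos.mpr (hpos x hx).ne') 5)
    linarith [heqφ x hx]
  refine not_strict_supersolution hR hu huc hub hpos fun x hx => ?_
  have hux := hpos x hx
  have h₁ : 0 < q * |u x| ^ 3 * u x * φ x :=
    mul_pos (mul_pos (mul_pos hq (pow_pos (abs_pos.mpr hux.ne') 3)) hux) (hφpos x hx)
  have h₂ : (π / R) ^ 2 * u x ≤ lam * u x := by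
    rw [div_pow]; exact mul_le_mul_of_nonneg_right hlam hux.le
  linarith [hequ x hx]
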